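/- Let α > 0. Then the integer translates of the fractional B-spline B_α form a partition of unity: for every t ∈ ℝ the family (B_α(t − k))_{k∈ℤ} is summable and ∑_{k∈ℤ} B_α(t − k) = 1. (This is the degree-0 case of the property that the spaces spanned by translates of B_α reproduce polynomials up to degree ⌈α⌉.) -/

import Mathlib

/-- Generalized binomial coefficient: binom(x, k) = (∏_{i=0}^{k-1} (x - i)) / k!. -/
noncomputable def gbinom (x : ℝ) (k : ℕ) : ℝ :=
  (∏ i ∈ Finset.range k, (x - i)) / k.factorial

/-- Fractional truncated power: t_+^α := t^α for t > 0 and 0 for t ≤ 0. -/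
noncomputable def tpow (t α : ℝ) : ℝ := if 0 < t then t ^ α else 0

/-- Fractional B-spline of degree α. -/
noncomputable def fracBspline (α : ℝ) (t : ℝ) : ℝ :=
  (1 / Real.Gamma (α + 1)) * ∑' k : ℕ, (-1 : ℝ) ^ k * gbinom (α + 1) k * tpow (t - k) α

open Finset MeasureTheory Filter Topology

theorem gbinom_zero (x : ℝ) : gbinom x 0 = 1 := by simp [gbinom]

theorem gbinom_succ (x : ℝ) (k : ℕ) : gbinom x (k + 1) = gbinom x k * ((x - k) / (k + 1)) := by
  simp only [gbinom, prod_range_succ, Nat.factorial_succ]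
  push_cast
  field_simp

theorem gbinom_add_one (x : ℝ) (k : ℕ) :
    gbinom (x + 1) (k + 1) = gbinom x (k + 1) + gbinom x k := by
  induction k with
  | zero => simp [gbinom]
  | succ k ih =>
    rw [gbinom_succ, ih, gbinom_succ x (k + 1), gbinom_succ x k]
    push_cast
    field_simp
    ring

theorem gbinom_eq_choose (x : ℝ) (k : ℕ) : gbinom x k = Ring.choose x k := by
  rw [Ring.choose_eq_smul, smul_eq_mul, gbinom, div_eq_inv_mul, ← Polynomial.aeval_eq_smeval,
    Polynomial.aeval_def, ← Polynomial.eval_map, descPochhammer_map,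
    descPochhammer_eval_eq_prod_range]

theorem neg_one_pow_mul_gbinom_neg {θ : ℝ} (hθ : 0 < θ) (j : ℕ) :
    Real.Gamma (j + θ) / j.factorial = Real.Gamma θ * ((-1) ^ j * gbinom (-θ) j) := by
  induction j with
  | zero => simp [gbinom]
  | succ j ih =>
    have : (j : ℝ) + θ ≠ 0 := by positivity
    rw [gbinom_succ, Nat.factorial_succ, Nat.cast_succ, add_right_comm, Real.Gamma_add_one this,
      Nat.cast_mul, pow_succ]
    push_cast
    calc (j + θ) * Real.Gamma (j + θ) / ((j + 1) * j.factorial)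
        = (j + θ) / (j + 1) * (Real.Gamma (j + θ) / j.factorial) := by field_simp
      _ = _ := by rw [ih]; field_simp; ring

theorem sum_gbinom_mul_Gamma {θ : ℝ} (hθ : 0 < θ) (n : ℕ) :
    ∑ k ∈ range (n + 1), (-1) ^ k * gbinom θ k *
      (Real.Gamma ((n - k : ℕ) + θ) / (n - k).factorial) = if n = 0 then Real.Gamma θ else 0 := by
  have h := Ring.add_choose_eq (r := θ) (s := -θ) n (Commute.all _ _)
  rw [add_neg_cancel, Ring.choose_zero_ite, Nat.sum_antidiagonal_eq_sum_range_succ_mk] at h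
  simp only [← gbinom_eq_choose] at h
  calc _ = ∑ k ∈ range (n + 1), (-1) ^ n * Real.Gamma θ * (gbinom θ k * gbinom (-θ) (n - k)) := by
        refine sum_congr rfl fun k hk => ?_
        rw [neg_one_pow_mul_gbinom_neg hθ]
        obtain ⟨m, rfl⟩ := Nat.exists_eq_add_of_le (Nat.lt_succ_iff.1 (mem_range.1 hk))
        rw [Nat.add_sub_cancel_left, pow_add]
        ring
    _ = _ := by
        rw [← mul_sum, ← h]
        split_ifs with h0 <;> simp [h0]

theorem sum_range_neg_one_pow_mul_gbinom (θ : ℝ) (n : ℕ) :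
    ∑ k ∈ range (n + 1), (-1) ^ k * gbinom θ k = ∏ i ∈ range n, (1 - θ / (i + 1)) := by
  have key : ∀ n : ℕ, ∑ k ∈ range (n + 1), (-1) ^ k * gbinom θ k = (-1) ^ n * gbinom (θ - 1) n := by
    intro n
    induction n with
    | zero => simp [gbinom]
    | succ n ih =>
      have := gbinom_add_one (θ - 1) n
      rw [sub_add_cancel] at this
      rw [sum_range_succ, ih, this, pow_succ]
      ring
  rw [key]
  induction n with
  | zero => simp [gbinom]
  | succ n ih =>
    rw [prod_range_succ, ← ih, gbinom_succ, pow_succ]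
    field_simp
    ring

theorem tendsto_prod_one_sub_div {θ : ℝ} (hθ : 0 < θ) (hθ1 : θ ≤ 1) :
    Tendsto (fun n : ℕ => ∏ i ∈ range n, (1 - θ / (i + 1))) atTop (𝓝 0) := by
  have h0 : ∀ i : ℕ, 0 ≤ 1 - θ / ((i : ℝ) + 1) := fun i => by
    rw [sub_nonneg, div_le_one (by positivity)]
    linarith [(Nat.cast_nonneg i : (0 : ℝ) ≤ i)]
  have hlim : Tendsto (fun n : ℕ => Real.exp (-(θ * ∑ i ∈ range n, 1 / ((i : ℝ) + 1))))
      atTop (𝓝 0) :=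
    Real.tendsto_exp_neg_atTop_nhds_zero.comp
      (Real.tendsto_sum_range_one_div_nat_succ_atTop.const_mul_atTop hθ)
  refine squeeze_zero (fun n => prod_nonneg fun i _ => h0 i) (fun n => ?_) hlim
  rw [mul_sum, ← sum_neg_distrib, Real.exp_sum]
  refine prod_le_prod (fun i _ => h0 i) fun i _ => ?_
  have := Real.add_one_le_exp (-(θ * (1 / ((i : ℝ) + 1))))
  rw [mul_one_div] at this ⊢
  linarith

theorem neg_one_pow_mul_gbinom_nonpos {θ : ℝ} (hθ : 0 < θ) (hθ1 : θ ≤ 1) (k : ℕ) :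
    (-1) ^ (k + 1) * gbinom θ (k + 1) ≤ 0 := by
  induction k with
  | zero => simpa [gbinom] using hθ.le
  | succ k ih =>
    rw [gbinom_succ, pow_succ]
    have : 0 ≤ (((k + 1 : ℕ) : ℝ) - θ) / ((k + 1 : ℕ) + 1) := by
      push_cast
      exact div_nonneg (by linarith [(Nat.cast_nonneg k : (0 : ℝ) ≤ k)]) (by positivity)
    calc _ = ((-1) ^ (k + 1) * gbinom θ (k + 1)) * ((((k + 1 : ℕ) : ℝ) - θ) / ((k + 1 : ℕ) + 1)) := by
          ring
      _ ≤ 0 := mul_nonpos_of_nonpos_of_nonneg ih this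

theorem hasSum_neg_one_pow_mul_gbinom {θ : ℝ} (hθ : 0 < θ) (hθ1 : θ ≤ 1) :
    HasSum (fun k : ℕ => (-1) ^ k * gbinom θ k) 0 := by
  have hlim : Tendsto (fun n : ℕ => ∑ k ∈ range (n + 1), (-1) ^ k * gbinom θ k) atTop (𝓝 0) := by
    simpa only [sum_range_neg_one_pow_mul_gbinom] using tendsto_prod_one_sub_div hθ hθ1
  have h1 : HasSum (fun k : ℕ => -((-1) ^ (k + 1) * gbinom θ (k + 1))) 1 := by
    rw [hasSum_iff_tendsto_nat_of_nonneg
      fun k => neg_nonneg.2 (neg_one_pow_mul_gbinom_nonpos hθ hθ1 k)]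
    have := hlim.const_sub 1
    simp only [sum_range_succ', sum_neg_distrib] at this ⊢
    simpa [gbinom_zero] using this
  rw [← hasSum_nat_add_iff' 1]
  simpa [gbinom_zero] using h1.neg

theorem tpow_of_nonpos {x : ℝ} (hx : x ≤ 0) (a : ℝ) : tpow x a = 0 := if_neg hx.not_gt

theorem tpow_of_pos {x : ℝ} (hx : 0 < x) (a : ℝ) : tpow x a = x ^ a := if_pos hx

theorem measurable_tpow (a : ℝ) : Measurable fun x => tpow x a :=
  Measurable.ite measurableSet_Ioi (by fun_prop) measurable_const

theorem tsum_mul_comp_sub_natCast {f : ℝ → ℝ} (hf : ∀ x ≤ 0, f x = 0) (c : ℕ → ℝ) {x : ℝ} {N : ℕ}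
    (hx : x ≤ N) : ∑' k : ℕ, c k * f (x - k) = ∑ k ∈ range N, c k * f (x - k) := by
  refine tsum_eq_sum fun k hk => ?_
  have : (N : ℝ) ≤ k := by exact_mod_cast not_lt.1 fun h => hk (mem_range.2 h)
  rw [hf _ (by linarith), mul_zero]

/-- The step function equal to `Γ (n + θ) / n!` on `(n, n + 1]`, comparable to `x ^ (θ - 1)`. -/
noncomputable def gammaStep (θ x : ℝ) : ℝ :=
  if 0 < x then Real.Gamma ((⌈x⌉₊ - 1 : ℕ) + θ) / (⌈x⌉₊ - 1).factorial else 0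

theorem gammaStep_of_nonpos (θ : ℝ) {x : ℝ} (hx : x ≤ 0) : gammaStep θ x = 0 := if_neg hx.not_gt

theorem measurable_gammaStep (θ : ℝ) : Measurable (gammaStep θ) := by
  refine Measurable.ite measurableSet_Ioi ?_ measurable_const
  exact (measurable_from_nat (f := fun n : ℕ =>
    Real.Gamma ((n - 1 : ℕ) + θ) / (n - 1).factorial)).comp Nat.measurable_ceil

theorem exists_natCeil_eq_succ {x : ℝ} (hx : 0 < x) :
    ∃ n : ℕ, ⌈x⌉₊ = n + 1 ∧ (n : ℝ) < x ∧ x ≤ n + 1 := by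
  obtain ⟨n, hn⟩ : ∃ n, ⌈x⌉₊ = n + 1 := Nat.exists_eq_succ_of_ne_zero (Nat.ceil_pos.2 hx).ne'
  have h := (Nat.ceil_eq_iff n.succ_ne_zero).1 hn
  exact ⟨n, hn, by simpa using h⟩

theorem tsum_gbinom_mul_gammaStep {θ : ℝ} (hθ : 0 < θ) (x : ℝ) :
    ∑' k : ℕ, (-1) ^ k * gbinom θ k * gammaStep θ (x - k) =
      (Set.Ioc 0 1).indicator (fun _ => Real.Gamma θ) x := by
  rw [tsum_mul_comp_sub_natCast (fun y hy => gammaStep_of_nonpos θ hy) _ (Nat.le_ceil x)]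
  rcases le_or_gt x 0 with hx | hx
  · rw [Nat.ceil_eq_zero.2 hx, Set.indicator_of_notMem fun h => hx.not_gt h.1]
    simp
  obtain ⟨n, hn, h1, h2⟩ := exists_natCeil_eq_succ hx
  rw [hn]
  calc _ = ∑ k ∈ range (n + 1), (-1) ^ k * gbinom θ k *
        (Real.Gamma ((n - k : ℕ) + θ) / (n - k).factorial) := by
        refine sum_congr rfl fun k hk => ?_
        have hk : k ≤ n := Nat.lt_succ_iff.1 (mem_range.1 hk)
        have hk' : (k : ℝ) ≤ n := by exact_mod_cast hk
        have hpos : 0 < x - k := by linarith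
        rw [gammaStep, if_pos hpos, Nat.ceil_sub_natCast, hn, show n + 1 - k - 1 = n - k by omega]
    _ = _ := by
        rw [sum_gbinom_mul_Gamma hθ]
        split_ifs with h0
        · subst h0
          rw [Set.indicator_of_mem (Set.mem_Ioc.2 ⟨hx, by simpa using h2⟩)]
        · have : (1 : ℝ) ≤ n := by exact_mod_cast Nat.one_le_iff_ne_zero.2 h0
          rw [Set.indicator_of_notMem fun h => by linarith [h.2]]

theorem Gamma_add_div_factorial_le {θ : ℝ} (hθ : 0 < θ) (hθ1 : θ ≤ 1) {j : ℕ} (hj : 0 < j) :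
    Real.Gamma (j + θ) / j.factorial ≤ (j : ℝ) ^ (θ - 1) := by
  have hj' : (0 : ℝ) < j := by exact_mod_cast hj
  rw [div_le_iff₀ (by positivity), ← Real.Gamma_nat_eq_factorial]
  rcases hθ1.eq_or_lt with rfl | hlt
  · simp
  have h := Real.Gamma_mul_add_mul_le_rpow_Gamma_mul_rpow_Gamma hj' (by linarith : (0 : ℝ) < j + 1)
    (sub_pos.2 hlt) hθ (by ring)
  rw [show (1 - θ) * (j : ℝ) + θ * (j + 1) = j + θ by ring, Real.Gamma_add_one hj'.ne'] at h
  have hG := Real.Gamma_pos_of_pos hj'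
  rw [Real.Gamma_add_one hj'.ne']
  refine h.trans_eq ?_
  rw [Real.mul_rpow hj'.le hG.le, mul_left_comm, ← Real.rpow_add hG, sub_add_cancel, Real.rpow_one,
    ← mul_assoc, ← Real.rpow_add_one hj'.ne', sub_add_cancel]

theorem le_Gamma_add_div_factorial {θ : ℝ} (hθ : 0 < θ) (hθ1 : θ ≤ 1) (j : ℕ) :
    ((j : ℝ) + 1) ^ (θ - 1) ≤ Real.Gamma (j + θ) / j.factorial := by
  have hj' : (0 : ℝ) ≤ j := j.cast_nonneg
  rw [le_div_iff₀ (by positivity), ← Real.Gamma_nat_eq_factorial]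
  rcases hθ1.eq_or_lt with rfl | hlt
  · simp
  have hp : (0 : ℝ) < j + θ := by positivity
  have h := Real.Gamma_mul_add_mul_le_rpow_Gamma_mul_rpow_Gamma hp
    (by linarith : (0 : ℝ) < j + θ + 1) hθ (sub_pos.2 hlt) (by ring)
  rw [show θ * ((j : ℝ) + θ) + (1 - θ) * (j + θ + 1) = j + 1 by ring,
    Real.Gamma_add_one hp.ne'] at h
  have hG := Real.Gamma_pos_of_pos hp
  rw [Real.mul_rpow hp.le hG.le, mul_left_comm, ← Real.rpow_add hG, add_sub_cancel,
    Real.rpow_one] at h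
  calc ((j : ℝ) + 1) ^ (θ - 1) * Real.Gamma (j + 1)
      ≤ ((j : ℝ) + 1) ^ (θ - 1) * (((j : ℝ) + 1) ^ (1 - θ) * Real.Gamma (j + θ)) := by
        gcongr
        refine h.trans ?_
        gcongr
    _ = _ := by
        rw [← mul_assoc, ← Real.rpow_add (by positivity)]
        simp

theorem rpow_sub_rpow_add_one_le {θ : ℝ} (hθ : 0 < θ) (hθ1 : θ ≤ 1) {y : ℝ} (hy : 0 < y) :
    y ^ (θ - 1) - (y + 1) ^ (θ - 1) ≤ (1 - θ) * y ^ (θ - 2) := by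
  have h := rpow_one_add_le_one_add_mul_self (s := y⁻¹) (p := 1 - θ)
    (by linarith [inv_pos.2 hy]) (by linarith) (by linarith)
  have h1 : y + 1 = y * (1 + y⁻¹) := by field_simp
  have h2 : (1 + y⁻¹) ^ (θ - 1) = ((1 + y⁻¹) ^ (1 - θ))⁻¹ := by
    rw [← Real.rpow_neg (by positivity), neg_sub]
  have h3 : 1 - (1 - θ) * y⁻¹ ≤ ((1 + y⁻¹) ^ (1 - θ))⁻¹ := by
    have hA : 0 < (1 + y⁻¹) ^ (1 - θ) := by positivity
    have h5 : 2 - (1 + y⁻¹) ^ (1 - θ) ≤ ((1 + y⁻¹) ^ (1 - θ))⁻¹ := by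
      rw [← sub_nonneg]
      have : ((1 + y⁻¹) ^ (1 - θ))⁻¹ - (2 - (1 + y⁻¹) ^ (1 - θ)) =
        ((1 + y⁻¹) ^ (1 - θ) - 1) ^ 2 * ((1 + y⁻¹) ^ (1 - θ))⁻¹ := by
        field_simp
        ring
      rw [this]
      positivity
    linarith
  rw [h1, Real.mul_rpow hy.le (by positivity), h2,
    show θ - 2 = θ - 1 - 1 by ring, Real.rpow_sub_one hy.ne' (θ - 1)]
  have := mul_le_mul_of_nonneg_left h3 (Real.rpow_nonneg hy.le (θ - 1))
  calc _ ≤ y ^ (θ - 1) - y ^ (θ - 1) * (1 - (1 - θ) * y⁻¹) := by linarith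
    _ = _ := by ring

theorem abs_tpow_sub_gammaStep_le {θ : ℝ} (hθ : 0 < θ) (hθ1 : θ ≤ 1) {x : ℝ} (hx : 1 < x) :
    |tpow x (θ - 1) - gammaStep θ x| ≤ (1 - θ) * (x / 2) ^ (θ - 2) := by
  have hx0 : 0 < x := by linarith
  obtain ⟨n, hn, h1, h2⟩ := exists_natCeil_eq_succ hx0
  have hn0 : 0 < n := by
    rw [Nat.pos_iff_ne_zero]
    rintro rfl
    norm_num at h2
    linarith
  have hn1 : (1 : ℝ) ≤ n := by exact_mod_cast hn0
  rw [tpow_of_pos hx0, gammaStep, if_pos hx0, hn, Nat.add_sub_cancel]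
  have e1 := Gamma_add_div_factorial_le hθ hθ1 hn0
  have e2 := le_Gamma_add_div_factorial hθ hθ1 n
  have e3 := Real.rpow_le_rpow_of_nonpos (by linarith : (0 : ℝ) < n) h1.le (sub_nonpos.2 hθ1)
  have e4 := Real.rpow_le_rpow_of_nonpos hx0 h2 (sub_nonpos.2 hθ1)
  have e5 := rpow_sub_rpow_add_one_le hθ hθ1 (by linarith : (0 : ℝ) < n)
  have e6 : (n : ℝ) ^ (θ - 2) ≤ (x / 2) ^ (θ - 2) :=
    Real.rpow_le_rpow_of_nonpos (by linarith) (by linarith) (by linarith)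
  have e7 := mul_le_mul_of_nonneg_left e6 (sub_nonneg.2 hθ1)
  rw [abs_le]
  constructor <;> linarith

theorem integrable_tpow_sub_gammaStep {θ : ℝ} (hθ : 0 < θ) (hθ1 : θ ≤ 1) :
    Integrable fun x => tpow x (θ - 1) - gammaStep θ x := by
  have hm : Measurable fun x => tpow x (θ - 1) - gammaStep θ x :=
    (measurable_tpow _).sub (measurable_gammaStep θ)
  rw [← integrableOn_univ, ← Set.Iic_union_Ioi (a := (1 : ℝ)),
    ← Set.Iic_union_Ioc_eq_Iic (zero_le_one' ℝ)]
  refine IntegrableOn.union (IntegrableOn.union ?_ ?_) ?_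
  · refine integrableOn_zero.congr_fun (fun x hx => ?_) measurableSet_Iic
    simp [tpow_of_nonpos hx, gammaStep_of_nonpos θ hx]
  · have h : IntegrableOn (fun x : ℝ => x ^ (θ - 1) - Real.Gamma θ) (Set.Ioc 0 1) := by
      rw [← intervalIntegrable_iff_integrableOn_Ioc_of_le zero_le_one]
      exact (intervalIntegral.intervalIntegrable_rpow' (by linarith)).sub
        intervalIntegrable_const
    refine h.congr_fun (fun x hx => ?_) measurableSet_Ioc
    have : ⌈x⌉₊ = 1 := (Nat.ceil_eq_iff one_ne_zero).2 (by simpa using hx)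
    simp [tpow_of_pos hx.1, gammaStep, hx.1, this]
  · rcases hθ1.eq_or_lt with rfl | hlt
    · refine integrableOn_zero.congr_fun (fun x hx => ?_) measurableSet_Ioi
      have := abs_tpow_sub_gammaStep_le hθ le_rfl hx
      rw [sub_self, zero_mul, abs_nonpos_iff] at this
      simpa only [sub_self] using this.symm
    · have h : IntegrableOn (fun x : ℝ => (1 - θ) * (x / 2) ^ (θ - 2)) (Set.Ioi 1) := by
        have := ((integrableOn_Ioi_rpow_of_lt (by linarith : θ - 2 < -1) one_pos).mul_const
          ((2 : ℝ) ^ (θ - 2))⁻¹).const_mul (1 - θ)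
        refine IntegrableOn.congr_fun this (fun x hx => ?_) measurableSet_Ioi
        have hx : (1 : ℝ) < x := hx
        rw [Real.div_rpow (by linarith) zero_le_two, div_eq_mul_inv]
      refine Integrable.mono' h hm.aestronglyMeasurable ?_
      filter_upwards [ae_restrict_mem measurableSet_Ioi] with x hx
      exact abs_tpow_sub_gammaStep_le hθ hθ1 hx

theorem integrable_tsum_of_summable_integral_norm {f : ℕ → ℝ → ℝ} (hm : ∀ k, Measurable (f k))
    (hf : ∀ k, Integrable (f k)) (hs : Summable fun k => ∫ x, ‖f k x‖)
    (hp : ∀ x, Summable fun k => f k x) : Integrable fun x => ∑' k, f k x := by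
  refine ⟨(measurable_of_tendsto_metrizable (fun n => Finset.measurable_sum (range n)
    fun k _ => hm k) (tendsto_pi_nhds.2 fun x => ?_)).aestronglyMeasurable, ?_⟩
  · simpa using (hp x).hasSum.tendsto_sum_nat
  · calc ∫⁻ x, ‖∑' k, f k x‖ₑ ≤ ∫⁻ x, ∑' k, ‖f k x‖ₑ :=
          lintegral_mono fun x => enorm_tsum_le_tsum_enorm
      _ = ∑' k, ∫⁻ x, ‖f k x‖ₑ := lintegral_tsum fun k => (hm k).enorm.aemeasurable
      _ = ∑' k, ENNReal.ofReal (∫ x, ‖f k x‖) := by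
          simp only [ofReal_integral_norm_eq_lintegral_enorm (hf _)]
      _ < ⊤ := by
          rw [← ENNReal.ofReal_tsum_of_nonneg (fun k => integral_nonneg fun x => norm_nonneg _) hs]
          exact ENNReal.ofReal_lt_top

theorem summable_mul_comp_sub_natCast {f : ℝ → ℝ} (hf : ∀ x ≤ 0, f x = 0) (c : ℕ → ℝ) (x : ℝ) :
    Summable fun k : ℕ => c k * f (x - k) := by
  refine summable_of_ne_finset_zero (s := range ⌈x⌉₊) fun k hk => ?_
  have : x ≤ k := Nat.ceil_le.1 (not_lt.1 fun h => hk (mem_range.2 h))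
  rw [hf _ (by linarith), mul_zero]

/-- Replacing `x ^ (θ - 1)` by the step function `gammaStep θ` turns the B-spline into the
indicator of `(0, 1]`; the error is a series of translates of an integrable function. -/
theorem fracBspline_sub_one_eq {θ : ℝ} (hθ : 0 < θ) (x : ℝ) :
    fracBspline (θ - 1) x = 1 / Real.Gamma θ *
      ((Set.Ioc 0 1).indicator (fun _ => Real.Gamma θ) x +
        ∑' k : ℕ, (-1) ^ k * gbinom θ k * (tpow (x - k) (θ - 1) - gammaStep θ (x - k))) := by
  have hx := Nat.le_ceil x
  rw [fracBspline, sub_add_cancel, ← tsum_gbinom_mul_gammaStep hθ,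
    tsum_mul_comp_sub_natCast (f := fun y => tpow y (θ - 1)) (fun y hy => tpow_of_nonpos hy _) _ hx,
    tsum_mul_comp_sub_natCast (f := fun y => tpow y (θ - 1) - gammaStep θ y)
      (fun y hy => by simp [tpow_of_nonpos hy, gammaStep_of_nonpos θ hy]) _ hx,
    tsum_mul_comp_sub_natCast (fun y hy => gammaStep_of_nonpos θ hy) _ hx, ← sum_add_distrib]
  congr 1
  exact sum_congr rfl fun k _ => by ring

theorem integrable_fracBspline_sub_one_and_integral_eq_one {θ : ℝ} (hθ : 0 < θ) (hθ1 : θ ≤ 1) :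
    Integrable (fracBspline (θ - 1)) ∧ ∫ x, fracBspline (θ - 1) x = 1 := by
  set r : ℝ → ℝ := fun x => tpow x (θ - 1) - gammaStep θ x with hr
  have hr_int : Integrable r := integrable_tpow_sub_gammaStep hθ hθ1
  have hr_meas : Measurable r := (measurable_tpow _).sub (measurable_gammaStep θ)
  have hr0 : ∀ x ≤ 0, r x = 0 := fun x hx => by
    simp [hr, tpow_of_nonpos hx, gammaStep_of_nonpos θ hx]
  have hd := hasSum_neg_one_pow_mul_gbinom hθ hθ1
  have hF : ∀ k : ℕ, Integrable fun x => (-1) ^ k * gbinom θ k * r (x - k) := fun k =>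
    (hr_int.comp_sub_right _).const_mul _
  have hFs : Summable fun k : ℕ => ∫ x, ‖(-1) ^ k * gbinom θ k * r (x - k)‖ := by
    simp only [norm_mul (_ * _), integral_const_mul,
      integral_sub_right_eq_self (fun x => ‖r x‖) (_ : ℝ)]
    exact hd.summable.norm.mul_right _
  have hsum := (hasSum_integral_of_summable_integral_norm hF hFs).tsum_eq
  simp only [integral_const_mul, integral_sub_right_eq_self r (_ : ℝ)] at hsum
  rw [tsum_mul_right, hd.tsum_eq, zero_mul] at hsum
  have hI : Integrable fun x => ∑' k : ℕ, (-1) ^ k * gbinom θ k * r (x - k) :=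
    integrable_tsum_of_summable_integral_norm
      (fun k => (hr_meas.comp (measurable_id.sub_const _)).const_mul _) hF hFs
      (summable_mul_comp_sub_natCast hr0 _)
  have hJ : Integrable ((Set.Ioc (0 : ℝ) 1).indicator fun _ => Real.Gamma θ) :=
    (integrable_indicator_iff measurableSet_Ioc).2 (integrableOn_const (by simp))
  rw [funext (fracBspline_sub_one_eq hθ)]
  refine ⟨(hJ.add hI).const_mul _, ?_⟩
  rw [integral_const_mul, integral_add hJ hI, ← hsum, integral_indicator measurableSet_Ioc]
  simp [(Real.Gamma_pos_of_pos hθ).ne']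

theorem intervalIntegrable_tpow {a : ℝ} (ha : -1 < a) (x y : ℝ) :
    IntervalIntegrable (fun u => tpow u a) volume x y := by
  have h := intervalIntegral.intervalIntegrable_rpow' (a := x) (b := y) ha
  rw [intervalIntegrable_iff] at h ⊢
  exact Integrable.indicator h measurableSet_Ioi

theorem integral_zero_tpow {a : ℝ} (ha : -1 < a) (y : ℝ) :
    ∫ u in 0..y, tpow u a = tpow y (a + 1) / (a + 1) := by
  rcases le_or_gt y 0 with hy | hy
  · rw [intervalIntegral.integral_symm, intervalIntegral.integral_of_le hy,
      setIntegral_congr_fun (g := fun _ => (0 : ℝ)) measurableSet_Ioc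
        fun u hu => tpow_of_nonpos hu.2 a, tpow_of_nonpos hy]
    simp
  · have h := integral_rpow (a := 0) (b := y) (Or.inl ha)
    rw [Real.zero_rpow (by linarith), sub_zero] at h
    rw [tpow_of_pos hy, ← h, intervalIntegral.integral_of_le hy.le,
      intervalIntegral.integral_of_le hy.le]
    exact setIntegral_congr_fun measurableSet_Ioc fun u hu => tpow_of_pos hu.1 a

theorem integral_tpow {a : ℝ} (ha : -1 < a) (x y : ℝ) :
    ∫ u in x..y, tpow u a = (tpow y (a + 1) - tpow x (a + 1)) / (a + 1) := by
  rw [← intervalIntegral.integral_interval_sub_left (intervalIntegrable_tpow ha 0 y)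
    (intervalIntegrable_tpow ha 0 x), integral_zero_tpow ha, integral_zero_tpow ha, sub_div]

/-- `B_{a+1}` is the moving average of `B_a` over windows of length one. -/
theorem integral_fracBspline {a : ℝ} (ha : -1 < a) (t : ℝ) :
    ∫ u in (t - 1)..t, fracBspline a u = fracBspline (a + 1) t := by
  have ha' : a + 1 ≠ 0 := by linarith
  have hG : Real.Gamma (a + 1) ≠ 0 := (Real.Gamma_pos_of_pos (by linarith)).ne'
  have ht := Nat.le_ceil t
  set N := ⌈t⌉₊
  have h0 : ∀ b, ∀ y ≤ 0, (fun y => tpow y b) y = 0 := fun b y hy => tpow_of_nonpos hy b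
  have hL : ∀ u ∈ Set.uIcc (t - 1) t, fracBspline a u = 1 / Real.Gamma (a + 1) *
      ∑ k ∈ range N, (-1) ^ k * gbinom (a + 1) k * tpow (u - k) a := fun u hu => by
    rw [Set.uIcc_of_le (by linarith)] at hu
    rw [fracBspline, tsum_mul_comp_sub_natCast (h0 a) _ (hu.2.trans ht)]
  have ht' : t ≤ (N + 1 : ℕ) := by
    push_cast
    linarith
  rw [intervalIntegral.integral_congr hL, intervalIntegral.integral_const_mul,
    intervalIntegral.integral_finsetSum fun k _ => ?_, fracBspline,
    tsum_mul_comp_sub_natCast (h0 (a + 1)) _ ht', Real.Gamma_add_one ha', sum_range_succ']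
  · have hR : ∑ k ∈ range N, (-1) ^ (k + 1) * gbinom (a + 1 + 1) (k + 1) *
        tpow (t - (k + 1 : ℕ)) (a + 1) + (-1) ^ 0 * gbinom (a + 1 + 1) 0 * tpow (t - (0 : ℕ)) (a + 1)
        = ∑ k ∈ range N, (-1) ^ k * gbinom (a + 1) k * tpow (t - k) (a + 1) -
          ∑ k ∈ range N, (-1) ^ k * gbinom (a + 1) k * tpow (t - 1 - k) (a + 1) := by
      have hN := sum_range_succ (fun k : ℕ => (-1) ^ k * gbinom (a + 1) k * tpow (t - k) (a + 1)) N
      rw [tpow_of_nonpos (by linarith : t - N ≤ 0), mul_zero, add_zero, sum_range_succ'] at hN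
      rw [← hN, gbinom_zero, gbinom_zero, add_sub_right_comm, ← sum_sub_distrib]
      congr 1
      refine sum_congr rfl fun k _ => ?_
      rw [gbinom_add_one, show t - 1 - (k : ℝ) = t - (k + 1 : ℕ) by push_cast; ring]
      ring
    rw [hR, ← sum_sub_distrib, mul_sum, mul_sum]
    refine sum_congr rfl fun k _ => ?_
    rw [intervalIntegral.integral_const_mul,
      intervalIntegral.integral_comp_sub_right (fun u => tpow u a), integral_tpow ha]
    field_simp
  · have := (intervalIntegrable_tpow ha (t - 1 - k) (t - k)).comp_sub_right (k : ℝ)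
    simp only [sub_add_cancel] at this
    exact this.const_mul _

open scoped Convolution in
theorem integrable_integral_sub_one {f : ℝ → ℝ} (hf : Integrable f) :
    Integrable (fun t => ∫ u in (t - 1)..t, f u) ∧
      ∫ t, (∫ u in (t - 1)..t, f u) = ∫ u, f u := by
  set g : ℝ → ℝ := (Set.Ioc (0 : ℝ) 1).indicator fun _ => 1
  have hg : Integrable g :=
    (integrable_indicator_iff measurableSet_Ioc).2 (integrableOn_const (by simp))
  have hgi : ∫ t, g t = 1 := by
    rw [integral_indicator measurableSet_Ioc]
    simp
  have key : (fun t => ∫ u in (t - 1)..t, f u) =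
      (g ⋆[ContinuousLinearMap.mul ℝ ℝ, volume] f) := by
    funext t
    have h : ∀ u, ContinuousLinearMap.mul ℝ ℝ (g u) (f (t - u)) =
        (Set.Ioc (0 : ℝ) 1).indicator (fun u => f (t - u)) u := fun u => by
      by_cases hu : u ∈ Set.Ioc (0 : ℝ) 1 <;> simp [g, hu]
    simp only [convolution_def, h]
    rw [integral_indicator measurableSet_Ioc, ← intervalIntegral.integral_of_le zero_le_one,
      intervalIntegral.integral_comp_sub_left, sub_zero]
  rw [key]
  refine ⟨hg.integrable_convolution _ hf, ?_⟩
  rw [integral_convolution _ hg hf, hgi]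
  simp

theorem integrable_fracBspline_and_integral_eq_one {a : ℝ} (ha : -1 < a) :
    Integrable (fracBspline a) ∧ ∫ x, fracBspline a x = 1 := by
  have key : ∀ (n : ℕ) (θ : ℝ), 0 < θ → θ ≤ 1 →
      Integrable (fracBspline (θ - 1 + n)) ∧ ∫ x, fracBspline (θ - 1 + n) x = 1 := by
    intro n θ hθ hθ1
    induction n with
    | zero => simpa using integrable_fracBspline_sub_one_and_integral_eq_one hθ hθ1
    | succ n ih =>
      have hn : -1 < θ - 1 + n := by linarith [(Nat.cast_nonneg n : (0 : ℝ) ≤ n)]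
      have h := integrable_integral_sub_one ih.1
      simp only [integral_fracBspline hn, ih.2] at h
      rw [Nat.cast_succ, ← add_assoc]
      exact h
  obtain ⟨n, -, h1, h2⟩ := exists_natCeil_eq_succ (by linarith : 0 < a + 1)
  have h := key n (a + 1 - n) (by linarith) (by linarith)
  rwa [show a + 1 - n - 1 + n = a by ring] at h

/-- The integer translates of the fractional B-spline form a partition of unity. -/
theorem fracBspline_partition_of_unity (α : ℝ) (hα : 0 < α) (t : ℝ) :
    Summable (fun k : ℤ => fracBspline α (t - k)) ∧
      ∑' k : ℤ, fracBspline α (t - k) = 1 := by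
  obtain ⟨hi, h1⟩ := integrable_fracBspline_and_integral_eq_one (by linarith : -1 < α - 1)
  have h := (Equiv.neg ℤ).hasSum_iff.2 (hi.hasSum_intervalIntegral (t - 1))
  have hs : HasSum (fun k : ℤ => fracBspline α (t - k)) 1 := by
    rw [h1] at h
    refine (congrArg (HasSum · 1) (funext fun k => ?_)).mpr h
    have := integral_fracBspline (by linarith : -1 < α - 1) (t - k)
    rw [sub_add_cancel] at this
    rw [← this]
    simp only [Function.comp_apply, Equiv.neg_apply, Int.cast_neg]
    congr 1 <;> ring
  exact ⟨hs.summable, hs.tsum_eq⟩
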